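/- For every n ≥ 7: (a) every cop-win graph G on n vertices satisfies cr(G) − r(G) ≤ n − 4, where r(G) = 1 if G is tp1 and r(G) = 0 if G is tp0 (by the corner-rank characterization, cr(G) − r(G) is exactly the capture time of G, so this says capt(n) = n − 4); and (b) there exists a cop-win graph G on n vertices with cr(G) − r(G) = n − 4. -/

import Mathlib

namespace CopsRobbers

variable {V : Type*}

/-- The closed neighborhood of `v` within the vertex set `S` (graphs are reflexive,
so `v` itself belongs to its closed neighborhood). -/
def closedNbhd (G : SimpleGraph V) (S : Set V) (v : V) : Set V :=
  {u | u ∈ S ∧ (u = v ∨ G.Adj u v)}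

/-- `v` is a strict corner of the subgraph induced on `S`: some other vertex `w ∈ S`
strictly corners `v`, i.e. `N[v] ⊊ N[w]` within `S`. -/
def StrictCorner (G : SimpleGraph V) (S : Set V) (v : V) : Prop :=
  v ∈ S ∧ ∃ w ∈ S, w ≠ v ∧ closedNbhd G S v ⊂ closedNbhd G S w

/-- The remaining vertex sets of the corner ranking procedure (0-indexed auxiliary
version): at each step all current strict corners are removed. -/
def stageAux (G : SimpleGraph V) : ℕ → Set V
  | 0 => Set.univ
  | n + 1 => stageAux G n \ {v | StrictCorner G (stageAux G n) v}

/-- `stage G k` is the vertex set of `G^(k)` (for `k ≥ 1`), so `stage G 1 = V(G)`. -/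
def stage (G : SimpleGraph V) (k : ℕ) : Set V := stageAux G (k - 1)

/-- The corner rank of a vertex: the least `k ≥ 1` such that `v` is a strict corner
of `G^(k)`, or `G^(k)` is a clique still containing `v`; and `⊤` (that is, `∞`) if
there is no such `k`. -/
noncomputable def cornerRank (G : SimpleGraph V) (v : V) : ℕ∞ :=
  sInf {k : ℕ∞ | ∃ n : ℕ, k = (n : ℕ∞) ∧ 1 ≤ n ∧
    (StrictCorner G (stage G n) v ∨ (G.IsClique (stage G n) ∧ v ∈ stage G n))}

/-- The corner rank of a graph: the largest corner rank of a vertex. -/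
noncomputable def graphRank (G : SimpleGraph V) : ℕ∞ := ⨆ v, cornerRank G v

/-- A graph is cop-win iff every vertex has finite corner rank. -/
def CopWin (G : SimpleGraph V) : Prop := ∀ v, cornerRank G v ≠ ⊤

/-- `v` dominates the set `S`: `v` is (reflexively) adjacent to every vertex of `S`. -/
def Dominates (G : SimpleGraph V) (v : V) (S : Set V) : Prop :=
  ∀ u ∈ S, u = v ∨ G.Adj v u

/-- A cop-win graph of corner rank `α ≥ 2` is `tp1` if some vertex of corner rank `α`
dominates the vertex set of `G^(α-1)`. -/
def Tp1 (G : SimpleGraph V) : Prop :=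
  ∃ α : ℕ, 2 ≤ α ∧ graphRank G = (α : ℕ∞) ∧
    ∃ v, cornerRank G v = (α : ℕ∞) ∧ Dominates G v (stage G (α - 1))

/-- `G` realizes the vector `(x_α, …, x_1)` (written as the list `[x_α, …, x_1]`):
`G` is cop-win of corner rank `α` and for each `k`, `x_k` is the number of vertices
of corner rank `k`. -/
def Realizes (G : SimpleGraph V) (x : List ℕ) : Prop :=
  CopWin G ∧ graphRank G = (x.length : ℕ∞) ∧
  ∀ i : Fin x.length,
    x.get i = {v | cornerRank G v = ((x.length - (i : ℕ) : ℕ) : ℕ∞)}.ncard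

/-- `G` r-realizes `x` (for `r ∈ {0,1}`): `G` realizes `x` and `G` is tp-r. -/
def RRealizes (G : SimpleGraph V) (r : ℕ) (x : List ℕ) : Prop :=
  Realizes G x ∧ (Tp1 G ↔ r = 1)

/-- A vector is realizable if it is the rank cardinality vector of some finite cop-win graph. -/
def Realizable (x : List ℕ) : Prop :=
  ∃ (W : Type) (_ : Fintype W) (G : SimpleGraph W), Realizes G x

/-- A vector is r-realizable if some finite tp-r cop-win graph realizes it. -/
def RRealizable (r : ℕ) (x : List ℕ) : Prop :=
  ∃ (W : Type) (_ : Fintype W) (G : SimpleGraph W), RRealizes G r x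

open Classical in
/-- The capture time of a cop-win graph: `cr(G) - r(G)`. -/
noncomputable def captureTime (G : SimpleGraph V) : ℕ :=
  (graphRank G).toNat - (if Tp1 G then 1 else 0)

end CopsRobbers

namespace CopsRobbers

variable {V : Type*}

/-- Reflexive adjacency. -/
def Near (G : SimpleGraph V) (u v : V) : Prop := u = v ∨ G.Adj u v

/-- The set of strict corners of the subgraph induced on `S`. -/
def corners (G : SimpleGraph V) (S : Set V) : Set V := {v | StrictCorner G S v}

/-- What remains of `S` after its strict corners are removed. -/
def peel (G : SimpleGraph V) (S : Set V) : Set V := S \ corners G S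

section General

variable {G : SimpleGraph V} {S : Set V} {u v w : V}

lemma Near.symm (h : Near G u v) : Near G v u := h.imp Eq.symm fun h => h.symm

lemma peel_subset : peel G S ⊆ S := Set.sdiff_subset

lemma corners_subset : corners G S ⊆ S := fun _ h => h.1

lemma strictCorner_of_ssubset (hv : v ∈ S) (hw : w ∈ S)
    (h : closedNbhd G S v ⊂ closedNbhd G S w) : StrictCorner G S v :=
  ⟨hv, w, hw, by rintro rfl; exact h.ne rfl, h⟩

lemma closedNbhd_subset_of_dominates (h : Dominates G w S) :
    closedNbhd G S v ⊆ closedNbhd G S w :=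
  fun x hx => ⟨hx.1, (h x hx.1).imp id fun h => h.symm⟩

lemma not_mem_corners_of_dominates (h : Dominates G v S) : v ∉ corners G S :=
  fun ⟨_, _, _, _, hw⟩ => hw.2 (closedNbhd_subset_of_dominates h)

lemma exists_mem_peel_of_strictCorner [Finite V] (h : StrictCorner G S v) :
    ∃ w ∈ peel G S, closedNbhd G S v ⊂ closedNbhd G S w := by
  obtain ⟨hv, w, hw, -, hvw⟩ := h
  obtain ⟨z, ⟨hz, hvz⟩, hmax⟩ := (Set.toFinite
    {w | w ∈ S ∧ closedNbhd G S v ⊂ closedNbhd G S w}).exists_maximalFor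
      (closedNbhd G S) _ ⟨w, hw, hvw⟩
  refine ⟨z, ⟨hz, fun hc => ?_⟩, hvz⟩
  obtain ⟨-, y, hy, -, hzy⟩ := hc
  exact hzy.2 (hmax ⟨hy, hvz.trans hzy⟩ hzy.1)

lemma peel_nonempty [Finite V] (h : S.Nonempty) : (peel G S).Nonempty := by
  obtain ⟨v, hv⟩ := h
  by_cases hc : StrictCorner G S v
  · obtain ⟨w, hw, -⟩ := exists_mem_peel_of_strictCorner hc
    exact ⟨w, hw⟩
  · exact ⟨v, hv, hc⟩

lemma ncard_eq_corners_add_peel [Finite V] :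
    S.ncard = (corners G S).ncard + (peel G S).ncard := by
  rw [peel, add_comm, Set.ncard_sdiff_add_ncard_of_subset corners_subset]

/-- If `w` strictly corners `u` only after the corners of `S` have been removed, then some
corner of `S` distinguishes them. -/
lemma exists_corner_near_not_near (hu : u ∈ peel G S) (hw : w ∈ peel G S)
    (h : closedNbhd G (peel G S) u ⊂ closedNbhd G (peel G S) w) :
    ∃ x ∈ corners G S, Near G x u ∧ ¬ Near G x w := by
  by_contra! hcon
  refine hu.2 (strictCorner_of_ssubset hu.1 hw.1 ⟨fun x hx => ⟨hx.1, ?_⟩, fun hsub => ?_⟩)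
  · by_cases hxc : x ∈ corners G S
    · exact hcon x hxc hx.2
    · exact (h.1 ⟨⟨hx.1, hxc⟩, hx.2⟩).2
  · exact h.2 fun x hx => ⟨hx.1, (hsub ⟨hx.1.1, hx.2⟩).2⟩

/-- When the peeled set is a clique, a vertex near all strict corners dominates. -/
lemma dominates_of_near_corners [Finite V] (hT : G.IsClique (peel G S)) (hw : w ∈ S)
    (h : ∀ c ∈ corners G S, Near G c w) : Dominates G w S := by
  have hclique : ∀ x ∈ peel G S, ∀ y ∈ peel G S, Near G x y := fun x hx y hy => by
    by_cases hxy : x = y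
    · exact Or.inl hxy
    · exact Or.inr (hT hx hy hxy)
  suffices H : ∀ x ∈ S, Near G x w from fun x hx => (H x hx).imp id fun h => h.symm
  intro x hx
  by_cases hxc : x ∈ corners G S
  · exact h x hxc
  by_cases hwc : w ∈ corners G S
  · obtain ⟨t, ht, hwt⟩ := exists_mem_peel_of_strictCorner hwc
    have htd : closedNbhd G S t = S := by
      refine Set.Subset.antisymm (fun y hy => hy.1) fun y hy => ?_
      by_cases hyc : y ∈ corners G S
      · exact hwt.1 ⟨hy, h y hyc⟩
      · exact ⟨hy, hclique y ⟨hy, hyc⟩ t ht⟩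
    by_contra hxw
    refine hxc (strictCorner_of_ssubset hx ht.1 ⟨fun y hy => htd.symm ▸ hy.1, fun hs => ?_⟩)
    exact hxw (Near.symm (hs (htd.symm ▸ hw)).2)
  · exact hclique x ⟨hx, hxc⟩ w ⟨hw, hwc⟩

lemma corners_nonempty_of_peel_ne (h : peel G S ≠ S) : (corners G S).Nonempty := by
  by_contra hne
  exact h (by simp [peel, Set.not_nonempty_iff_eq_empty.mp hne])

lemma two_le_ncard_of_not_singleton [Finite V] (h : S.Nonempty) (h1 : ∀ v, S ≠ {v}) :
    2 ≤ S.ncard := by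
  have hpos := (Set.ncard_pos (Set.toFinite S)).mpr h
  have : S.ncard ≠ 1 := fun h => by
    obtain ⟨v, hv⟩ := Set.ncard_eq_one.mp h
    exact h1 v hv
  omega

lemma two_le_ncard_corners [Finite V] (hT : G.IsClique (peel G S)) (hS : ¬ G.IsClique S) :
    2 ≤ (corners G S).ncard := by
  refine two_le_ncard_of_not_singleton
    (corners_nonempty_of_peel_ne fun h => hS (h ▸ hT)) fun v hv => ?_
  have hvc : v ∈ corners G S := by simp [hv]
  refine not_mem_corners_of_dominates (dominates_of_near_corners hT hvc.1 fun c hc => ?_) hvc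
  rw [hv] at hc
  exact Or.inl hc

/-- The cornerer of a lone strict corner is near every strict corner of the next stage. -/
lemma exists_near_corners_of_singleton [Finite V] (hv : corners G S = {v}) :
    ∃ w ∈ peel G S, Near G v w ∧ ∀ c ∈ corners G (peel G S), Near G c w := by
  have hvc : v ∈ corners G S := by simp [hv]
  obtain ⟨w, hw, hvw⟩ := exists_mem_peel_of_strictCorner hvc
  refine ⟨w, hw, (hvw.1 ⟨hvc.1, Or.inl rfl⟩).2, fun c hc => ?_⟩
  obtain ⟨-, y, hy, -, hcy⟩ := id hc
  obtain ⟨x, hx, hxc, -⟩ := exists_corner_near_not_near hc.1 hy hcy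
  rw [hv] at hx
  obtain rfl : x = v := hx
  exact (hvw.1 ⟨hc.1.1, hxc.symm⟩).2

lemma two_le_ncard_corners_of_peel [Finite V] (hT : G.IsClique (peel G (peel G S)))
    (hC : ¬ G.IsClique (peel G S)) : 2 ≤ (corners G S).ncard := by
  refine two_le_ncard_of_not_singleton (corners_nonempty_of_peel_ne fun h => hC ?_)
    fun v hv => ?_
  · rwa [h, h, ← h] at hT
  · obtain ⟨w, hw, hvw, hwc⟩ := exists_near_corners_of_singleton hv
    have hdom := dominates_of_near_corners hT hw hwc
    obtain ⟨c, hc⟩ := corners_nonempty_of_peel_ne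
      (S := peel G S) (G := G) fun h => hC (h ▸ hT)
    obtain ⟨x, hx, -, hxw⟩ := exists_corner_near_not_near hc.1 hw
      ⟨closedNbhd_subset_of_dominates hdom, fun hsub => by
        obtain ⟨-, y, hy, -, hcy⟩ := id hc
        exact hcy.2 fun z hz => hsub (closedNbhd_subset_of_dominates hdom hz)⟩
    rw [hv] at hx
    obtain rfl : x = v := hx
    exact hxw hvw

/-- A lone strict corner is impossible three stages below a set consisting only of cornerers
`a`, `b` of the two vertices `c`, `d` removed last, when any vertex near both `c` and `d` is equal
to both `a` and `b`. -/
lemma false_of_small_layers [Finite V] {a b c d : V}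
    (hv : corners G S = {v})
    (hcd : corners G (peel G (peel G S)) = {c, d}) (hne : c ≠ d)
    (ha : a ∈ peel G (peel G S)) (hb : b ∈ peel G (peel G S))
    (hca : closedNbhd G (peel G (peel G S)) c ⊂ closedNbhd G (peel G (peel G S)) a)
    (hdb : closedNbhd G (peel G (peel G S)) d ⊂ closedNbhd G (peel G (peel G S)) b)
    (hab : ∀ z ∈ peel G (peel G (peel G S)), z = a ∨ z = b)
    (hnear : ∀ z ∈ peel G (peel G S), Near G c z → Near G d z → z = a ∧ z = b) : False := by
  have hc : c ∈ corners G (peel G (peel G S)) := by simp [hcd]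
  have hd : d ∈ corners G (peel G (peel G S)) := by simp [hcd]
  obtain ⟨x, hx, hxc, hxa⟩ := exists_corner_near_not_near hc.1 ha hca
  obtain ⟨y, hy, hyd, hyb⟩ := exists_corner_near_not_near hd.1 hb hdb
  have hxd : ¬ Near G x d := fun hxd => by
    obtain ⟨z, hz, hxz⟩ := exists_mem_peel_of_strictCorner hx
    obtain ⟨rfl, -⟩ := hnear z hz (hxz.1 ⟨hc.1.1, hxc.symm⟩).2 (hxz.1 ⟨hd.1.1, hxd.symm⟩).2
    exact hxa (hxz.1 ⟨hx.1, Or.inl rfl⟩).2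
  have hyc : ¬ Near G y c := fun hyc => by
    obtain ⟨z, hz, hyz⟩ := exists_mem_peel_of_strictCorner hy
    obtain ⟨-, rfl⟩ := hnear z hz (hyz.1 ⟨hc.1.1, hyc.symm⟩).2 (hyz.1 ⟨hd.1.1, hyd.symm⟩).2
    exact hyb (hyz.1 ⟨hy.1, Or.inl rfl⟩).2
  obtain ⟨w, hw, hwx, hwy⟩ : ∃ w ∈ peel G (peel G S), Near G x w ∧ Near G y w := by
    obtain ⟨w, hw, -, hwc⟩ := exists_near_corners_of_singleton hv
    by_cases hwB : w ∈ corners G (peel G S)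
    · obtain ⟨z, hz, hwz⟩ := exists_mem_peel_of_strictCorner hwB
      exact ⟨z, hz, (hwz.1 ⟨hx.1, hwc x hx⟩).2, (hwz.1 ⟨hy.1, hwc y hy⟩).2⟩
    · exact ⟨w, ⟨hw, hwB⟩, hwc x hx, hwc y hy⟩
  by_cases hwC : w ∈ corners G (peel G (peel G S))
  · rw [hcd] at hwC
    rcases hwC with rfl | rfl
    · exact hyc hwy
    · exact hxd hwx
  · rcases hab w ⟨hw, hwC⟩ with rfl | rfl
    · exact hxa hwx
    · exact hyb hwy

lemma ncard_of_four_layers [Finite V] (hS : S.Nonempty)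
    (hT : G.IsClique (peel G (peel G (peel G S)))) (hC : ¬ G.IsClique (peel G (peel G S))) :
    7 ≤ S.ncard ∧
    ((∀ v ∈ peel G (peel G (peel G S)), ¬ Dominates G v (peel G (peel G S))) →
      8 ≤ S.ncard) := by
  have h1 : 1 ≤ (corners G S).ncard := by
    refine (Set.ncard_pos (Set.toFinite _)).mpr
      (corners_nonempty_of_peel_ne fun h => hC ?_)
    rw [h, h, h] at hT
    rwa [h, h]
  have h2 := two_le_ncard_corners_of_peel hT hC
  have h3 := two_le_ncard_corners hT hC
  have e1 := ncard_eq_corners_add_peel (G := G) (S := S)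
  have e2 := ncard_eq_corners_add_peel (G := G) (S := peel G S)
  have e3 := ncard_eq_corners_add_peel (G := G) (S := peel G (peel G S))
  have h4 : 1 ≤ (peel G (peel G (peel G S))).ncard :=
    (Set.ncard_pos (Set.toFinite _)).mpr (peel_nonempty (peel_nonempty (peel_nonempty hS)))
  have hnd : ∀ z ∈ peel G (peel G S),
      (∀ c ∈ corners G (peel G (peel G S)), Near G c z) →
      z ∈ peel G (peel G (peel G S)) ∧ Dominates G z (peel G (peel G S)) := fun z hz h => by
    have := dominates_of_near_corners hT hz h
    exact ⟨⟨hz, not_mem_corners_of_dominates this⟩, this⟩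
  have key : (corners G S).ncard = 1 →
      (corners G (peel G (peel G S))).ncard = 2 →
      ((peel G (peel G (peel G S))).ncard = 1 ∨ (peel G (peel G (peel G S))).ncard = 2 ∧
        ∀ v ∈ peel G (peel G (peel G S)), ¬ Dominates G v (peel G (peel G S))) → False := by
    intro k1 k3 k4
    obtain ⟨v, hv⟩ := Set.ncard_eq_one.mp k1
    obtain ⟨c, d, hne, hcd⟩ := Set.ncard_eq_two.mp k3
    have hc : c ∈ corners G (peel G (peel G S)) := by simp [hcd]
    have hd : d ∈ corners G (peel G (peel G S)) := by simp [hcd]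
    obtain ⟨a, ha, hca⟩ := exists_mem_peel_of_strictCorner hc
    obtain ⟨b, hb, hdb⟩ := exists_mem_peel_of_strictCorner hd
    have hall : ∀ z, Near G c z → Near G d z →
        ∀ x ∈ corners G (peel G (peel G S)), Near G x z := fun z hz1 hz2 x hx => by
      rw [hcd] at hx
      rcases hx with rfl | rfl
      · exact hz1
      · exact hz2
    refine false_of_small_layers hv hcd hne ha.1 hb.1 hca hdb ?_ ?_
    · rcases k4 with k4 | ⟨k4, hnod⟩
      · obtain ⟨t, ht⟩ := Set.ncard_eq_one.mp k4
        rw [ht] at ha ⊢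
        intro z hz
        exact Or.inl (hz.trans ha.symm)
      · have hab : a ≠ b := by
          rintro rfl
          exact hnod a ha (hnd a ha.1 (hall a (hca.1 ⟨hc.1, Or.inl rfl⟩).2
            (hdb.1 ⟨hd.1, Or.inl rfl⟩).2)).2
        have : ({a, b} : Set V) = peel G (peel G (peel G S)) :=
          Set.eq_of_subset_of_ncard_le (Set.pair_subset ha hb)
            (by rw [k4, Set.ncard_pair hab]) (Set.toFinite _)
        rw [← this]
        exact fun z hz => hz
    · intro z hz hz1 hz2
      obtain ⟨hzT, hzd⟩ := hnd z hz (hall z hz1 hz2)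
      rcases k4 with k4 | ⟨-, hnod⟩
      · obtain ⟨t, ht⟩ := Set.ncard_eq_one.mp k4
        rw [ht] at ha hb hzT
        exact ⟨hzT.trans ha.symm, hzT.trans hb.symm⟩
      · exact (hnod z hzT hzd).elim
  refine ⟨?_, fun hnod => ?_⟩
  · by_contra hlt
    exact key (by omega) (by omega) (Or.inl (by omega))
  · by_contra hlt
    have h5 : (peel G (peel G (peel G S))).ncard ≠ 1 := fun h => by
      obtain ⟨t, ht⟩ := Set.ncard_eq_one.mp h
      have htT : t ∈ peel G (peel G (peel G S)) := by simp [ht]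
      refine hnod t htT (hnd t htT.1 fun c hc => ?_).2
      obtain ⟨w, hw, hcw⟩ := exists_mem_peel_of_strictCorner hc
      rw [ht] at hw
      obtain rfl : w = t := hw
      exact (hcw.1 ⟨hc.1, Or.inl rfl⟩).2
    exact key (by omega) (by omega) (Or.inr ⟨by omega, hnod⟩)

end General

section Rank

variable {G : SimpleGraph V} {a : ℕ} {v : V}

lemma stageAux_succ (k : ℕ) : stageAux G (k + 1) = peel G (stageAux G k) := rfl

lemma stageAux_antitone : Antitone (stageAux G) :=
  antitone_nat_of_succ_le fun _ => peel_subset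

lemma stageAux_nonempty [Finite V] [Nonempty V] (k : ℕ) : (stageAux G k).Nonempty := by
  induction k with
  | zero => exact Set.univ_nonempty
  | succ k ih => exact peel_nonempty ih

lemma exists_strictCorner_of_notMem_stageAux {k : ℕ} (h : v ∉ stageAux G k) :
    ∃ j < k, StrictCorner G (stageAux G j) v := by
  induction k with
  | zero => exact (h trivial).elim
  | succ k ih =>
    by_cases hv : v ∈ stageAux G k
    · exact ⟨k, k.lt_succ_self, by_contra fun hc => h ⟨hv, hc⟩⟩
    · obtain ⟨j, hj, hc⟩ := ih hv
      exact ⟨j, hj.trans k.lt_succ_self, hc⟩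

lemma notMem_stageAux_of_strictCorner {j k : ℕ} (hjk : j < k)
    (h : StrictCorner G (stageAux G j) v) : v ∉ stageAux G k :=
  fun hv => (stageAux_antitone (Nat.succ_le_of_lt hjk) hv).2 h

lemma cornerRank_le_of_strictCorner {j : ℕ} (h : StrictCorner G (stageAux G j) v) :
    cornerRank G v ≤ (j + 1 : ℕ) :=
  sInf_le ⟨j + 1, rfl, by omega, Or.inl h⟩

lemma cornerRank_le_of_mem (ha : G.IsClique (stageAux G a)) (hv : v ∈ stageAux G a) :
    cornerRank G v ≤ (a + 1 : ℕ) :=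
  sInf_le ⟨a + 1, rfl, by omega, Or.inr ⟨ha, hv⟩⟩

lemma cornerRank_le (ha : G.IsClique (stageAux G a)) : cornerRank G v ≤ (a + 1 : ℕ) := by
  by_cases hv : v ∈ stageAux G a
  · exact cornerRank_le_of_mem ha hv
  · obtain ⟨j, hj, hc⟩ := exists_strictCorner_of_notMem_stageAux hv
    exact (cornerRank_le_of_strictCorner hc).trans (by exact_mod_cast (by omega))

lemma cornerRank_eq_iff (ha : G.IsClique (stageAux G a))
    (hmin : ∀ k < a, ¬ G.IsClique (stageAux G k)) :
    cornerRank G v = (a + 1 : ℕ) ↔ v ∈ stageAux G a := by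
  refine ⟨fun h => ?_, fun hv => le_antisymm (cornerRank_le ha) ?_⟩
  · by_contra hv
    obtain ⟨j, hj, hc⟩ := exists_strictCorner_of_notMem_stageAux hv
    have := cornerRank_le_of_strictCorner hc
    rw [h] at this
    have : a + 1 ≤ j + 1 := by exact_mod_cast this
    omega
  · refine le_sInf ?_
    rintro _ ⟨n, rfl, hn, h⟩
    have : a ≤ n - 1 := by
      by_contra! hlt
      rcases h with h | h
      · exact notMem_stageAux_of_strictCorner hlt h hv
      · exact hmin _ hlt h.1
    exact_mod_cast (by omega : a + 1 ≤ n)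

lemma graphRank_eq [Finite V] [Nonempty V] (ha : G.IsClique (stageAux G a))
    (hmin : ∀ k < a, ¬ G.IsClique (stageAux G k)) : graphRank G = (a + 1 : ℕ) := by
  refine le_antisymm (iSup_le fun v => cornerRank_le ha) ?_
  obtain ⟨v, hv⟩ := stageAux_nonempty (G := G) a
  rw [← (cornerRank_eq_iff ha hmin).mpr hv]
  exact le_iSup (cornerRank G) v

lemma tp1_iff [Finite V] [Nonempty V] (ha : G.IsClique (stageAux G a))
    (hmin : ∀ k < a, ¬ G.IsClique (stageAux G k)) :
    Tp1 G ↔ 1 ≤ a ∧ ∃ v ∈ stageAux G a, Dominates G v (stageAux G (a - 1)) := by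
  constructor
  · rintro ⟨α, hα, hr, v, hv, hd⟩
    rw [graphRank_eq ha hmin] at hr
    have : a + 1 = α := by exact_mod_cast hr
    subst this
    exact ⟨by omega, v, (cornerRank_eq_iff ha hmin).mp hv, hd⟩
  · rintro ⟨h1, v, hv, hd⟩
    exact ⟨a + 1, by omega, graphRank_eq ha hmin, v, (cornerRank_eq_iff ha hmin).mpr hv, hd⟩

lemma copWin_of_isClique (ha : G.IsClique (stageAux G a)) : CopWin G :=
  fun _ => ne_top_of_le_ne_top (ENat.natCast_ne_top (a + 1)) (cornerRank_le ha)

lemma exists_isClique_of_copWin [Finite V] [Nonempty V] (h : CopWin G) :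
    ∃ a, G.IsClique (stageAux G a) := by
  by_contra! hno
  have hex : ∀ v, ∃ k, v ∉ stageAux G k := fun v => by
    by_contra! hall
    refine h v (sInf_eq_top.mpr ?_)
    rintro _ ⟨n, rfl, -, hn | hn⟩
    · exact (notMem_stageAux_of_strictCorner (Nat.lt_succ_self _) hn (hall _)).elim
    · exact (hno _ hn.1).elim
  choose f hf using hex
  obtain ⟨N, hN⟩ := (Set.finite_range f).bddAbove
  obtain ⟨v, hv⟩ := stageAux_nonempty (G := G) N
  exact hf v (stageAux_antitone (hN ⟨v, rfl⟩) hv)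

lemma le_add_ncard_stageAux [Finite V] (ha : G.IsClique (stageAux G a))
    (hmin : ∀ k < a, ¬ G.IsClique (stageAux G k)) {k : ℕ} (hk : k ≤ a) :
    k + (stageAux G k).ncard ≤ Nat.card V := by
  induction k with
  | zero => simp [stageAux, Set.ncard_univ]
  | succ k ih =>
    have hne : peel G (stageAux G k) ≠ stageAux G k := fun h => by
      have hconst : ∀ i, stageAux G (k + i) = stageAux G k := fun i => by
        induction i with
        | zero => rfl
        | succ i ih => rw [← add_assoc, stageAux_succ, ih, h]
      obtain ⟨i, rfl⟩ := Nat.exists_eq_add_of_le (Nat.le_of_succ_le hk)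
      exact hmin k hk (hconst i ▸ ha)
    have h1 := (Set.ncard_pos (Set.toFinite _)).mpr (corners_nonempty_of_peel_ne hne)
    have h2 := ncard_eq_corners_add_peel (G := G) (S := stageAux G k)
    have h3 := ih (Nat.le_of_succ_le hk)
    rw [stageAux_succ]
    omega

lemma captureTime_le [Finite V] (hcard : 7 ≤ Nat.card V) (h : CopWin G) :
    captureTime G ≤ Nat.card V - 4 := by
  classical
  have : Nonempty V := (Nat.card_pos_iff.mp (by omega)).1
  have hex := exists_isClique_of_copWin h
  obtain ⟨a, ha, hmin⟩ : ∃ a, G.IsClique (stageAux G a) ∧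
      ∀ k < a, ¬ G.IsClique (stageAux G k) :=
    ⟨Nat.find hex, Nat.find_spec hex, fun k hk => Nat.find_min hex hk⟩
  have hrank : (graphRank G).toNat = a + 1 := by
    rw [graphRank_eq ha hmin, ENat.toNat_natCast]
  rw [captureTime, hrank]
  by_cases ha3 : a ≤ 2
  · omega
  obtain ⟨b, rfl⟩ : ∃ b, a = b + 3 := ⟨a - 3, by omega⟩
  have hcount := le_add_ncard_stageAux ha hmin (k := b) (by omega)
  obtain ⟨h7, h8⟩ := ncard_of_four_layers (stageAux_nonempty (G := G) b) ha
    (hmin (b + 2) (by omega))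
  split_ifs with htp
  · omega
  · have := h8 fun v hv hd => htp ((tp1_iff ha hmin).mpr ⟨by omega, v, hv, hd⟩)
    omega

end Rank

section Tail

/-- The edges, directed upwards, of a seven-vertex graph with capture time `3` whose only strict
corner is `6`. -/
def baseEdges : List (ℕ × ℕ) :=
  [(0, 1), (0, 2), (0, 3), (0, 5), (1, 2), (1, 3), (1, 4), (2, 4), (2, 5), (3, 4), (3, 5),
    (3, 6), (4, 6), (5, 6)]

/-- Reflexive adjacency on `ℕ` of the base graph with an infinite path attached at `6`. -/
def TailNear (i j : ℕ) : Prop :=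
  i = j ∨ ((i, j) ∈ baseEdges ∨ (j, i) ∈ baseEdges) ∨ (6 ≤ i ∧ j = i + 1) ∨ (6 ≤ j ∧ i = j + 1)

instance : DecidableRel TailNear := fun _ _ => by unfold TailNear; infer_instance

lemma TailNear.symm {i j : ℕ} (h : TailNear i j) : TailNear j i := by
  unfold TailNear at *
  tauto

/-- The base graph with a path attached at `6`, on `n` vertices. -/
def tailGraph (n : ℕ) : SimpleGraph (Fin n) where
  Adj i j := i ≠ j ∧ TailNear i j
  symm := ⟨fun _ _ h => ⟨h.1.symm, h.2.symm⟩⟩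
  loopless := ⟨fun _ h => h.1 rfl⟩

/-- The first `m` vertices. -/
def initialVertices (n m : ℕ) : Set (Fin n) := {i | i.val < m}

/-- `v` is a strict corner of the subgraph of the infinite tailed graph induced on `[0, m)`. -/
def TailCorner (m v : ℕ) : Prop :=
  ∃ w < m, (∀ u < m, TailNear u v → TailNear u w) ∧ ∃ u < m, TailNear u w ∧ ¬ TailNear u v

instance (m v : ℕ) : Decidable (TailCorner m v) := by unfold TailCorner; infer_instance

lemma near_tailGraph {n : ℕ} {i j : Fin n} : Near (tailGraph n) i j ↔ TailNear i j := by
  by_cases h : i = j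
  · simp [Near, h, TailNear]
  · simp [Near, h, tailGraph]

lemma strictCorner_tailGraph {n m : ℕ} (hm : m ≤ n) {v : Fin n} (hv : v.val < m) :
    StrictCorner (tailGraph n) (initialVertices n m) v ↔ TailCorner m v := by
  constructor
  · rintro ⟨-, w, hw, -, hsub, hne⟩
    refine ⟨w, hw, fun u hu h => ?_, ?_⟩
    · exact near_tailGraph.mp (hsub (a := ⟨u, hu.trans_le hm⟩) ⟨hu, near_tailGraph.mpr h⟩).2
    · by_contra! hcon
      exact hne fun u hu => ⟨hu.1, near_tailGraph.mpr (hcon u hu.1 (near_tailGraph.mp hu.2))⟩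
  · rintro ⟨w, hw, hsub, u, hu, huw, huv⟩
    refine strictCorner_of_ssubset (w := ⟨w, hw.trans_le hm⟩) hv hw
      ⟨fun x hx => ⟨hx.1, near_tailGraph.mpr (hsub x hx.1 (near_tailGraph.mp hx.2))⟩,
        fun h => huv ?_⟩
    exact near_tailGraph.mp (h (a := ⟨u, hu.trans_le hm⟩) ⟨hu, near_tailGraph.mpr huw⟩).2

lemma peel_initialVertices {n m m' : ℕ} (hm : m ≤ n) (hm' : m' ≤ m)
    (h : ∀ v < m, TailCorner m v ↔ m' ≤ v) :
    peel (tailGraph n) (initialVertices n m) = initialVertices n m' := by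
  ext v
  by_cases hv : v.val < m
  · have : v ∈ corners (tailGraph n) (initialVertices n m) ↔ m' ≤ v.val :=
      (strictCorner_tailGraph hm hv).trans (h v hv)
    rw [peel, Set.mem_sdiff, this]
    simp only [initialVertices, Set.mem_ofPred_eq]
    omega
  · simp only [peel, initialVertices, Set.mem_sdiff, Set.mem_ofPred_eq]
    omega

lemma lt_of_mem_baseEdges {i j : ℕ} (h : (i, j) ∈ baseEdges) : i < 6 ∧ j < 7 := by
  have : ∀ e ∈ baseEdges, e.1 < 6 ∧ e.2 < 7 := by decide
  exact this _ h

lemma TailNear.bound {i j : ℕ} (h : TailNear i j) :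
    i = j ∨ i < 7 ∧ j < 7 ∨ 6 ≤ i ∧ j = i + 1 ∨ 6 ≤ j ∧ i = j + 1 := by
  rcases h with h | (h | h) | h
  · exact Or.inl h
  · have := lt_of_mem_baseEdges h
    omega
  · have := lt_of_mem_baseEdges h
    omega
  · exact Or.inr (Or.inr h)

lemma tailCorner_iff {m : ℕ} (hm : 7 ≤ m) : ∀ v < m, TailCorner m v ↔ m - 1 ≤ v := by
  rcases hm.eq_or_lt with rfl | hm
  · decide
  intro v hv
  constructor
  · rintro ⟨w, hw, hsub, u, -, huw, huv⟩
    by_contra! hlt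
    have hwv : w ≠ v := by
      rintro rfl
      exact huv huw
    have hvw := (hsub v hv (Or.inl rfl)).bound
    rcases lt_trichotomy v 6 with h6 | rfl | h6
    · have hdec : ∀ v < 6, ∀ w < 7, w ≠ v → ∃ u < 7, TailNear u v ∧ ¬ TailNear u w := by decide
      obtain ⟨x, hx, hxv, hxw⟩ := hdec v h6 w (by omega) hwv
      exact hxw (hsub x (by omega) hxv)
    · have h7 := (hsub 7 (by omega) (by decide)).bound
      have h5 := (hsub 5 (by omega) (by decide)).bound
      omega
    · have h1 := (hsub (v + 1) (by omega) (by unfold TailNear; omega)).bound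
      have h2 := (hsub (v - 1) (by omega) (by unfold TailNear; omega)).bound
      omega
  · intro hle
    obtain rfl : v = m - 1 := by omega
    refine ⟨m - 2, by omega, fun u hu h => ?_, ?_⟩
    · have := h.bound
      unfold TailNear
      omega
    · rcases (Nat.succ_le_of_lt hm).eq_or_lt with rfl | hm
      · decide
      · refine ⟨m - 3, by omega, by unfold TailNear; omega, fun h => ?_⟩
        have := h.bound
        omega

lemma stageAux_tailGraph {n k : ℕ} (hk : k + 6 ≤ n) :
    stageAux (tailGraph n) k = initialVertices n (n - k) := by
  induction k with
  | zero => ext v; simp [stageAux, initialVertices]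
  | succ k ih =>
    rw [stageAux_succ, ih (by omega), Nat.sub_add_eq]
    exact peel_initialVertices (by omega) (by omega) (tailCorner_iff (by omega))

lemma stageAux_tailGraph_four (b : ℕ) :
    stageAux (tailGraph (b + 6)) (b + 1) = initialVertices (b + 6) 4 := by
  rw [stageAux_succ, stageAux_tailGraph le_rfl, Nat.add_sub_cancel_left]
  exact peel_initialVertices (by omega) (by omega) (by decide)

lemma stageAux_tailGraph_two (b : ℕ) :
    stageAux (tailGraph (b + 6)) (b + 2) = initialVertices (b + 6) 2 := by
  rw [stageAux_succ, stageAux_tailGraph_four]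
  exact peel_initialVertices (by omega) (by omega) (by decide)

lemma isClique_stageAux_tailGraph (b : ℕ) :
    (tailGraph (b + 6)).IsClique (stageAux (tailGraph (b + 6)) (b + 2)) := by
  rw [stageAux_tailGraph_two]
  intro i hi j hj hij
  have : ∀ i < 2, ∀ j < 2, TailNear i j := by decide
  exact ⟨hij, this i hi j hj⟩

lemma not_isClique_stageAux_tailGraph {b k : ℕ} (hk : k < b + 2) :
    ¬ (tailGraph (b + 6)).IsClique (stageAux (tailGraph (b + 6)) k) := by
  intro h
  have hsub : initialVertices (b + 6) 4 ⊆ stageAux (tailGraph (b + 6)) k :=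
    stageAux_tailGraph_four b ▸ stageAux_antitone (Nat.le_of_lt_succ hk)
  have hadj := h (x := ⟨2, by omega⟩) (y := ⟨3, by omega⟩) (hsub (by simp [initialVertices]))
    (hsub (by simp [initialVertices])) (by simp)
  exact absurd hadj.2 (show ¬ TailNear 2 3 by decide)

lemma captureTime_tailGraph (b : ℕ) : captureTime (tailGraph (b + 6)) = b + 2 := by
  have ha := isClique_stageAux_tailGraph b
  have hmin := fun k (hk : k < b + 2) => not_isClique_stageAux_tailGraph hk
  have htp : Tp1 (tailGraph (b + 6)) := by
    refine (tp1_iff ha hmin).mpr ⟨by omega, 0, ?_, ?_⟩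
    · simp [stageAux_tailGraph_two, initialVertices]
    · rw [show b + 2 - 1 = b + 1 from rfl, stageAux_tailGraph_four]
      intro u hu
      have : ∀ i < 4, TailNear i 0 := by decide
      exact (near_tailGraph.mpr (this u hu)).imp id fun h => h.symm
  rw [captureTime, if_pos htp, graphRank_eq ha hmin, ENat.toNat_natCast, Nat.add_sub_cancel]

end Tail

end CopsRobbers

/-- for `n ≥ 7`, every cop-win graph on `n` vertices has capture time
`cr(G) - r(G)` at most `n - 4`, and some cop-win graph on `n` vertices attains it. -/
theorem CopsRobbers.capt_eq_n_sub_four (n : ℕ) (hn : 7 ≤ n) :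
    (∀ (W : Type) (_ : Fintype W) (G : SimpleGraph W),
      Fintype.card W = n → CopsRobbers.CopWin G →
      CopsRobbers.captureTime G ≤ n - 4) ∧
    (∃ (W : Type) (_ : Fintype W) (G : SimpleGraph W),
      Fintype.card W = n ∧ CopsRobbers.CopWin G ∧
      CopsRobbers.captureTime G = n - 4) := by
  constructor
  · rintro W _ G rfl hG
    rw [← Nat.card_eq_fintype_card] at hn ⊢
    exact captureTime_le hn hG
  · obtain ⟨b, rfl⟩ := Nat.exists_eq_add_of_le' (show 6 ≤ n by omega)
    exact ⟨Fin (b + 6), inferInstance, tailGraph (b + 6), Fintype.card_fin _,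
      copWin_of_isClique (isClique_stageAux_tailGraph b), captureTime_tailGraph b⟩
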